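/- Let a, b, c, e ∈ ℂ with Re(1+b−e) > 0 and Re(e−a−b) > 0, and assume that c ≠ 0 and none of c, 2−e, c−e+2, c+1, a+b+c−2e+2, e−a−b, a−e+1, b−e+1, c−e+1, 1−a, 1−b, 1+a+c−e, 1+b+c−e is a nonpositive integer. Then ∑_{k=0}^∞ (b−e+1)_k (a−e+1)_k (c−e+1)_k / ((2−e)_k (a+b+c−2e+2)_k · k!) = −[Γ(2−e) Γ(a+b+c−2e+2) / (c · Γ(b−e+1) Γ(a−e+1) Γ(c−e+2))] · ∑_{k=0}^∞ (1+b+c−e)_k (1+a+c−e)_k (1)_k / ((2+c−e)_k (c+1)_k · k!) + Γ(e−a−b) Γ(c) Γ(2−e) Γ(a+b+c−2e+2) / (Γ(1−b) Γ(1+b+c−e) Γ(1−a) Γ(a+c−e+1)), where both series converge absolutely. -/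

import Mathlib

open Complex

/-- Pochhammer symbol `(a)_k = a (a+1) ⋯ (a+k-1)`. -/
noncomputable def poch (a : ℂ) (k : ℕ) : ℂ := ∏ i ∈ Finset.range k, (a + i)

open Filter Topology

theorem poch_succ (a : ℂ) (n : ℕ) : poch a (n + 1) = poch a n * (a + n) := by
  simp [poch, Finset.prod_range_succ]

theorem poch_add (a : ℂ) (n k : ℕ) : poch a (n + k) = poch a n * poch (a + n) k := by
  simp [poch, Finset.prod_range_add, add_assoc]

theorem poch_succ_left (a : ℂ) (n : ℕ) : poch a (n + 1) = a * poch (a + 1) n := by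
  rw [add_comm n 1, poch_add]
  simp [poch]

theorem poch_one_eq_factorial (n : ℕ) : poch 1 n = (n.factorial : ℂ) := by
  induction n with
  | zero => simp [poch]
  | succ n ih => rw [poch_succ, ih, Nat.factorial_succ]; push_cast; ring

theorem add_natCast_ne_zero {a : ℂ} (ha : ∀ m : ℕ, a ≠ -(m : ℂ)) (n : ℕ) : a + n ≠ 0 :=
  fun h => ha n (eq_neg_of_add_eq_zero_left h)

theorem add_natCast_ne_neg {a : ℂ} (ha : ∀ m : ℕ, a ≠ -(m : ℂ)) (n m : ℕ) :
    a + n ≠ -(m : ℂ) := fun h => ha (m + n) (by push_cast; linear_combination h)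

theorem add_one_ne_neg {a : ℂ} (ha : ∀ m : ℕ, a ≠ -(m : ℂ)) (m : ℕ) :
    a + 1 ≠ -(m : ℂ) := by simpa using add_natCast_ne_neg ha 1 m

theorem ne_zero_of_ne_neg {a : ℂ} (ha : ∀ m : ℕ, a ≠ -(m : ℂ)) : a ≠ 0 := by simpa using ha 0

theorem one_ne_neg (m : ℕ) : (1 : ℂ) ≠ -(m : ℂ) := fun h => by
  have := congrArg re h
  simp at this
  linarith [(Nat.cast_nonneg m : (0 : ℝ) ≤ m)]

theorem ne_neg_of_re_pos {a : ℂ} (ha : 0 < a.re) (m : ℕ) : a ≠ -(m : ℂ) := fun h => by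
  rw [h] at ha
  simp at ha
  linarith [(Nat.cast_nonneg m : (0 : ℝ) ≤ m)]

theorem poch_ne_zero {a : ℂ} (ha : ∀ m : ℕ, a ≠ -(m : ℂ)) (n : ℕ) : poch a n ≠ 0 :=
  Finset.prod_ne_zero_iff.mpr fun i _ => add_natCast_ne_zero ha i

theorem Gamma_add_natCast {a : ℂ} (ha : ∀ m : ℕ, a ≠ -(m : ℂ)) (n : ℕ) :
    Gamma (a + n) = poch a n * Gamma a := by
  induction n with
  | zero => simp [poch]
  | succ n ih =>
    rw [poch_succ, Nat.cast_succ, ← add_assoc, Gamma_add_one _ (add_natCast_ne_zero ha n), ih]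
    ring

theorem tendsto_natCast_add_inv (x : ℂ) :
    Tendsto (fun n : ℕ => (x + n)⁻¹) atTop (𝓝 0) := by
  have h := (tendsto_natCast_div_add_atTop x).mul (tendsto_inv_atTop_nhds_zero_nat (𝕜 := ℂ))
  rw [mul_zero] at h
  refine h.congr' ?_
  filter_upwards [eventually_gt_atTop 0] with n hn
  have : (n : ℂ) ≠ 0 := by exact_mod_cast hn.ne'
  rw [add_comm x]
  field_simp

theorem tendsto_add_natCast_div_add_natCast (x y : ℂ) :
    Tendsto (fun n : ℕ => (x + n) / (y + n)) atTop (𝓝 1) := by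
  have h := ((tendsto_natCast_add_inv y).const_mul x).add (tendsto_natCast_div_add_atTop y)
  rw [mul_zero, zero_add] at h
  refine h.congr fun n => ?_
  rw [add_comm (n : ℂ) y]
  ring

/-- Asymptotics of the Pochhammer symbol: `(a)_n ∼ n! (n + 1) ^ (a - 1) / Γ(a)`. -/
theorem tendsto_poch_div {a : ℂ} (ha : ∀ m : ℕ, a ≠ -(m : ℂ)) :
    Tendsto (fun n : ℕ => poch a n / (n.factorial * ((n : ℂ) + 1) ^ (a - 1))) atTop
      (𝓝 (Gamma a)⁻¹) := by
  have hG : Gamma a ≠ 0 := Gamma_ne_zero ha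
  have h1 : Tendsto (fun n : ℕ => ((n : ℂ) / (n + 1)) ^ a) atTop (𝓝 1) := by
    have h : ContinuousAt (fun z : ℂ => z ^ a) 1 := continuousAt_cpow_const (by simp)
    have := h.tendsto.comp (tendsto_natCast_div_add_atTop (1 : ℂ))
    simpa [Function.comp_def] using this
  have h2 := (h1.mul (tendsto_add_natCast_div_add_natCast 1 a)).mul
    ((GammaSeq_tendsto_Gamma a).inv₀ hG)
  rw [one_mul, one_mul] at h2
  refine h2.congr' ?_
  filter_upwards [eventually_gt_atTop 0] with n hn
  have hn0 : (n : ℂ) ≠ 0 := by exact_mod_cast hn.ne'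
  have hn1 : (n : ℂ) + 1 ≠ 0 := by exact_mod_cast n.succ_ne_zero
  have hdiv : (n : ℂ) ^ a = ((n : ℂ) / (n + 1)) ^ a * ((n : ℂ) + 1) ^ a := by
    have := mul_cpow_ofReal_nonneg (a := (n : ℝ) / (n + 1)) (b := n + 1) (by positivity)
      (by positivity) a
    push_cast at this
    rw [← this, div_mul_cancel₀ _ hn1]
  have hpos : ((n : ℂ) + 1) ^ a ≠ 0 := by simp [cpow_eq_zero_iff, hn1]
  have hx : ((n : ℂ) / (n + 1)) ^ a ≠ 0 := by
    simp [cpow_eq_zero_iff, hn0, hn1]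
  have hfac : (n.factorial : ℂ) ≠ 0 := by exact_mod_cast n.factorial_ne_zero
  have hp : (∏ j ∈ Finset.range (n + 1), (a + j)) = poch a n * (a + n) := poch_succ a n
  have := add_natCast_ne_zero ha n
  have := poch_ne_zero ha n
  rw [GammaSeq, hp, hdiv, cpow_sub _ _ hn1, cpow_one, add_comm 1 (n : ℂ)]
  field_simp

/-- The `k`-th term of the hypergeometric series `₃F₂(a, b, c; d, e; 1)`. -/
noncomputable def hypTerm (a b c d e : ℂ) (k : ℕ) : ℂ :=
  poch a k * poch b k * poch c k / (poch d k * poch e k * (k.factorial : ℂ))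

theorem hypTerm_zero (a b c d e : ℂ) : hypTerm a b c d e 0 = 1 := by simp [hypTerm, poch]

theorem hypTerm_succ {a b c d e : ℂ} (k : ℕ) :
    hypTerm a b c d e (k + 1) = hypTerm a b c d e k *
      ((a + k) * (b + k) * (c + k) / ((d + k) * (e + k) * (k + 1))) := by
  simp only [hypTerm, poch_succ, Nat.factorial_succ]
  push_cast
  rw [div_mul_div_comm]
  congr 1 <;> ring

theorem exists_hypTerm_eq {a b c d e : ℂ}
    (ha : ∀ m : ℕ, a ≠ -(m : ℂ)) (hb : ∀ m : ℕ, b ≠ -(m : ℂ)) (hc : ∀ m : ℕ, c ≠ -(m : ℂ))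
    (hd : ∀ m : ℕ, d ≠ -(m : ℂ)) (he : ∀ m : ℕ, e ≠ -(m : ℂ)) :
    ∃ r : ℕ → ℂ,
      Tendsto r atTop (𝓝 (Gamma d * Gamma e / (Gamma a * Gamma b * Gamma c))) ∧
      ∀ n : ℕ, hypTerm a b c d e n = r n * ((n : ℂ) + 1) ^ (a + b + c - d - e - 1) := by
  have hd0 := Gamma_ne_zero hd
  have he0 := Gamma_ne_zero he
  have ht := (((tendsto_poch_div ha).mul (tendsto_poch_div hb)).mul (tendsto_poch_div hc)).div
    ((tendsto_poch_div hd).mul (tendsto_poch_div he)) (by simp [hd0, he0])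
  have hlim : (Gamma a)⁻¹ * (Gamma b)⁻¹ * (Gamma c)⁻¹ / ((Gamma d)⁻¹ * (Gamma e)⁻¹) =
      Gamma d * Gamma e / (Gamma a * Gamma b * Gamma c) := by field_simp
  refine ⟨_, hlim ▸ ht, fun n => ?_⟩
  · have hn1 : (n : ℂ) + 1 ≠ 0 := by exact_mod_cast n.succ_ne_zero
    have hpos : ∀ z : ℂ, ((n : ℂ) + 1) ^ z ≠ 0 := fun z => by simp [cpow_eq_zero_iff, hn1]
    have hfac : (n.factorial : ℂ) ≠ 0 := by exact_mod_cast n.factorial_ne_zero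
    have := hpos a
    have := hpos b
    have := hpos c
    have := hpos d
    have := hpos e
    have := poch_ne_zero hd n
    have := poch_ne_zero he n
    simp only [hypTerm, Pi.div_apply, cpow_sub _ _ hn1, cpow_add _ _ hn1, cpow_one]
    field_simp

theorem exists_norm_hypTerm_le {a b c d e : ℂ}
    (ha : ∀ m : ℕ, a ≠ -(m : ℂ)) (hb : ∀ m : ℕ, b ≠ -(m : ℂ)) (hc : ∀ m : ℕ, c ≠ -(m : ℂ))
    (hd : ∀ m : ℕ, d ≠ -(m : ℂ)) (he : ∀ m : ℕ, e ≠ -(m : ℂ)) :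
    ∃ K : ℝ, 0 ≤ K ∧ ∀ n : ℕ,
      ‖hypTerm a b c d e n‖ ≤ K * ((n : ℝ) + 1) ^ (a + b + c - d - e - 1).re := by
  obtain ⟨r, hr, h⟩ := exists_hypTerm_eq ha hb hc hd he
  obtain ⟨K, hK⟩ := hr.norm.bddAbove_range
  have hK' : ∀ n, ‖r n‖ ≤ K := fun n => hK ⟨n, rfl⟩
  refine ⟨K, (norm_nonneg _).trans (hK' 0), fun n => ?_⟩
  have hn : (0 : ℝ) < (n : ℝ) + 1 := by positivity
  have := norm_cpow_eq_rpow_re_of_pos hn (a + b + c - d - e - 1)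
  push_cast at this
  rw [h, norm_mul, this]
  exact mul_le_mul_of_nonneg_right (hK' n) (by positivity)

theorem summable_add_one_rpow {s : ℝ} (hs : s < -1) :
    Summable fun n : ℕ => ((n : ℝ) + 1) ^ s := by
  simpa using (summable_nat_add_iff 1).mpr (Real.summable_nat_rpow.mpr hs)

theorem summable_norm_hypTerm {a b c d e : ℂ}
    (ha : ∀ m : ℕ, a ≠ -(m : ℂ)) (hb : ∀ m : ℕ, b ≠ -(m : ℂ)) (hc : ∀ m : ℕ, c ≠ -(m : ℂ))
    (hd : ∀ m : ℕ, d ≠ -(m : ℂ)) (he : ∀ m : ℕ, e ≠ -(m : ℂ))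
    (hs : 0 < (d + e - a - b - c).re) :
    Summable fun n => ‖hypTerm a b c d e n‖ := by
  obtain ⟨K, -, hK⟩ := exists_norm_hypTerm_le ha hb hc hd he
  refine Summable.of_nonneg_of_le (fun _ => norm_nonneg _) hK
    ((summable_add_one_rpow ?_).mul_left K)
  simp at hs ⊢
  linarith

theorem tsum_eq_of_telescoping {f g : ℕ → ℂ} {l : ℂ} (hf : Summable f)
    (h : ∀ k, f k = g (k + 1) - g k) (h0 : g 0 = 0) (hg : Tendsto g atTop (𝓝 l)) :
    ∑' k, f k = l := by
  refine tendsto_nhds_unique hf.hasSum.tendsto_sum_nat (hg.congr fun n => ?_)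
  rw [Finset.sum_congr rfl fun k _ => h k, Finset.sum_range_sub, h0, sub_zero]

/-- Contiguous relation for the Gauss series `₂F₁(a, b; d; 1)`. -/
theorem tsum_gauss_succ {a b d : ℂ}
    (ha : ∀ m : ℕ, a ≠ -(m : ℂ)) (hb : ∀ m : ℕ, b ≠ -(m : ℂ)) (hd : ∀ m : ℕ, d ≠ -(m : ℂ))
    (hs : 0 < (d - a - b).re) :
    ∑' k, hypTerm a b 1 d 1 k =
      (d - a) * (d - b) / (d * (d - a - b)) * ∑' k, hypTerm a b 1 (d + 1) 1 k := by
  have hd1 := add_one_ne_neg hd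
  have hd0 := ne_zero_of_ne_neg hd
  have hs0 : d - a - b ≠ 0 := ne_zero_of_ne_neg (ne_neg_of_re_pos hs)
  have s1 : Summable fun k => hypTerm a b 1 d 1 k :=
    (summable_norm_hypTerm ha hb one_ne_neg hd one_ne_neg (by
      simp at hs ⊢; linarith)).of_norm
  have s2 : Summable fun k => hypTerm a b 1 (d + 1) 1 k :=
    (summable_norm_hypTerm ha hb one_ne_neg hd1 one_ne_neg (by
      simp at hs ⊢; linarith)).of_norm
  have key : ∑' k, ((d - a - b) * hypTerm a b 1 d 1 k -
      (d - a) * (d - b) / d * hypTerm a b 1 (d + 1) 1 k) = 0 := by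
    refine tsum_eq_of_telescoping (g := fun k => -(k * hypTerm a b 1 d 1 k))
      ((s1.mul_left _).sub (s2.mul_left _)) (fun k => ?_) (by simp) ?_
    · have hk : hypTerm a b 1 (d + 1) 1 k = hypTerm a b 1 d 1 k * (d / (d + k)) := by
        have h := poch_succ_left d k
        rw [poch_succ] at h
        have hp := poch_ne_zero hd k
        have hp' := poch_ne_zero hd1 k
        have := poch_ne_zero one_ne_neg k
        have hk := add_natCast_ne_zero hd k
        have hfac : (k.factorial : ℂ) ≠ 0 := by exact_mod_cast k.factorial_ne_zero
        simp only [hypTerm]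
        have e1 : poch (d + 1) k = poch d k * (d + k) / d := by field_simp; linear_combination -h
        rw [e1]
        field_simp
      have hk0 := add_natCast_ne_zero hd k
      have hn1 : (k : ℂ) + 1 ≠ 0 := by exact_mod_cast k.succ_ne_zero
      have hn2 : 1 + (k : ℂ) ≠ 0 := by rwa [add_comm]
      rw [hk, hypTerm_succ]
      push_cast
      field_simp
      ring
    · obtain ⟨K, hK0, hK⟩ := exists_norm_hypTerm_le ha hb one_ne_neg hd one_ne_neg
      have hlim : Tendsto (fun n : ℕ => K * ((n : ℝ) + 1) ^ (-(d - a - b).re)) atTop (𝓝 0) := by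
        have h := (tendsto_rpow_neg_atTop hs).comp
          (tendsto_atTop_add_const_right atTop (1 : ℝ) tendsto_natCast_atTop_atTop)
        simpa using h.const_mul K
      refine squeeze_zero_norm (fun n => ?_) hlim
      have hn : (0 : ℝ) < (n : ℝ) + 1 := by positivity
      rw [norm_neg, norm_mul, Complex.norm_natCast]
      calc (n : ℝ) * ‖hypTerm a b 1 d 1 n‖
          ≤ ((n : ℝ) + 1) * (K * ((n : ℝ) + 1) ^ (a + b + 1 - d - 1 - 1).re) := by
            gcongr
            · linarith
            · exact hK n
        _ = K * ((n : ℝ) + 1) ^ (-(d - a - b).re) := by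
            have : (-(d - a - b).re) = (a + b + 1 - d - 1 - 1).re + 1 := by simp; ring
            rw [this, Real.rpow_add_one hn.ne']
            ring
  rw [(s1.mul_left _).tsum_sub (s2.mul_left _), tsum_mul_left, tsum_mul_left, sub_eq_zero] at key
  field_simp at key ⊢
  linear_combination key

theorem tsum_gauss_eq_mul_shift {a b d : ℂ}
    (ha : ∀ m : ℕ, a ≠ -(m : ℂ)) (hb : ∀ m : ℕ, b ≠ -(m : ℂ)) (hd : ∀ m : ℕ, d ≠ -(m : ℂ))
    (hs : 0 < (d - a - b).re) (n : ℕ) :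
    ∑' k, hypTerm a b 1 d 1 k =
      hypTerm (d - a) (d - b) 1 d (d - a - b) n * ∑' k, hypTerm a b 1 (d + n) 1 k := by
  induction n with
  | zero => simp [hypTerm_zero]
  | succ n ih =>
    have hn1 : (n : ℂ) + 1 ≠ 0 := by exact_mod_cast n.succ_ne_zero
    rw [ih, tsum_gauss_succ ha hb (add_natCast_ne_neg hd n) (by
      simp at hs ⊢; linarith [(Nat.cast_nonneg n : (0 : ℝ) ≤ n)]), hypTerm_succ, ← mul_assoc]
    push_cast
    rw [add_assoc d]
    congr 2
    rw [show d + (n : ℂ) - a - b = d - a - b + n by ring, show d + (n : ℂ) - a = d - a + n by ring,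
      show d + (n : ℂ) - b = d - b + n by ring, add_comm 1 (n : ℂ)]
    rw [mul_div_mul_right _ _ hn1]

theorem tendsto_tsum_gauss_shift {a b d : ℂ}
    (ha : ∀ m : ℕ, a ≠ -(m : ℂ)) (hb : ∀ m : ℕ, b ≠ -(m : ℂ)) :
    Tendsto (fun n : ℕ => ∑' k, hypTerm a b 1 (d + n) 1 k) atTop (𝓝 1) := by
  obtain ⟨N, hN⟩ := exists_nat_gt (|d.re| + |(a + b).re|)
  set M : ℝ := d.re + N with hM
  have hM0 : 0 < M := by linarith [neg_abs_le d.re, abs_nonneg (a + b).re]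
  have hMab : 0 < M - (a + b).re := by linarith [neg_abs_le d.re, le_abs_self (a + b).re]
  have hMne : ∀ m : ℕ, (M : ℂ) ≠ -(m : ℂ) := ne_neg_of_re_pos (by simpa using hM0)
  have hlim : ∀ k, Tendsto (fun n : ℕ => hypTerm a b 1 (d + n) 1 k) atTop
      (𝓝 (poch a k * poch b k / k.factorial * 0 ^ k)) := by
    intro k
    have h : Tendsto (fun n : ℕ => ∏ i ∈ Finset.range k, (d + i + n)⁻¹) atTop
        (𝓝 (∏ i ∈ Finset.range k, 0)) :=
      tendsto_finsetProd _ fun i _ => tendsto_natCast_add_inv (d + i)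
    rw [Finset.prod_const, Finset.card_range] at h
    refine (h.const_mul _).congr fun n => ?_
    have h1 := poch_ne_zero one_ne_neg k
    have : ∏ i ∈ Finset.range k, (d + i + n)⁻¹ = (poch (d + n) k)⁻¹ := by
      rw [poch, ← Finset.prod_inv_distrib]
      exact Finset.prod_congr rfl fun i _ => by rw [add_right_comm]
    rw [this, hypTerm]
    rw [mul_comm (poch (d + n) k), mul_assoc (poch 1 k), mul_comm _ (poch 1 k),
      mul_div_mul_left _ _ h1]
    ring
  have hbound : ∀ᶠ n : ℕ in atTop, ∀ k,
      ‖hypTerm a b 1 (d + n) 1 k‖ ≤ ‖hypTerm a b 1 M 1 k‖ := by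
    filter_upwards [eventually_ge_atTop N] with n hn k
    have hpos : 0 < ‖poch (M : ℂ) k‖ := norm_pos_iff.mpr (poch_ne_zero hMne k)
    have hle : ‖poch (M : ℂ) k‖ ≤ ‖poch (d + n) k‖ := by
      rw [poch, poch, norm_prod, norm_prod]
      refine Finset.prod_le_prod (fun _ _ => norm_nonneg _) fun i _ => ?_
      have hnN : (N : ℝ) ≤ n := by exact_mod_cast hn
      have h1 : ‖(M : ℂ) + i‖ = M + i := by
        rw [← ofReal_natCast, ← ofReal_add, norm_real, Real.norm_of_nonneg (by positivity)]
      rw [h1]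
      refine le_trans ?_ (re_le_norm _)
      simp
      linarith
    have := norm_pos_iff.mpr (poch_ne_zero one_ne_neg k)
    have hfac : 0 < (k.factorial : ℝ) := by positivity
    simp only [hypTerm, norm_div, norm_mul, Complex.norm_natCast]
    gcongr
  have hsum : Summable fun k => ‖hypTerm a b 1 M 1 k‖ :=
    summable_norm_hypTerm ha hb one_ne_neg hMne one_ne_neg (by simp at hMab ⊢; linarith)
  have h := tendsto_tsum_of_dominated_convergence hsum hlim hbound
  rwa [tsum_eq_single 0 (fun k hk => by simp [hk]), show
    poch a 0 * poch b 0 / (Nat.factorial 0 : ℂ) * 0 ^ 0 = 1 by simp [poch]] at h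

/-- Gauss's summation theorem. -/
theorem tsum_gauss {a b d : ℂ}
    (ha : ∀ m : ℕ, a ≠ -(m : ℂ)) (hb : ∀ m : ℕ, b ≠ -(m : ℂ)) (hd : ∀ m : ℕ, d ≠ -(m : ℂ))
    (hda : ∀ m : ℕ, d - a ≠ -(m : ℂ)) (hdb : ∀ m : ℕ, d - b ≠ -(m : ℂ))
    (hs : 0 < (d - a - b).re) :
    ∑' k, hypTerm a b 1 d 1 k =
      Gamma d * Gamma (d - a - b) / (Gamma (d - a) * Gamma (d - b)) := by
  obtain ⟨r, hr, h⟩ := exists_hypTerm_eq hda hdb one_ne_neg hd (ne_neg_of_re_pos hs)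
  have hlim := hr.mul (tendsto_tsum_gauss_shift (d := d) ha hb)
  rw [mul_one, Gamma_one, mul_one] at hlim
  refine tendsto_nhds_unique (tendsto_const_nhds.congr fun n => ?_) hlim
  rw [tsum_gauss_eq_mul_shift ha hb hd hs n, h,
    show d - a + (d - b) + 1 - d - (d - a - b) - 1 = 0 by ring, cpow_zero, mul_one]

/-- Inhomogeneous contiguous relation for Saalschützian `₃F₂(1)` series. -/
theorem tsum_saalschutzian_succ {A B C D E : ℂ} (hE : E = A + B + C + 1 - D)
    (hA : ∀ m : ℕ, A ≠ -(m : ℂ)) (hB : ∀ m : ℕ, B ≠ -(m : ℂ)) (hC : ∀ m : ℕ, C ≠ -(m : ℂ))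
    (hD : ∀ m : ℕ, D ≠ -(m : ℂ)) (hEn : ∀ m : ℕ, E ≠ -(m : ℂ)) (hCD : C - D + 1 ≠ 0) :
    ∑' k, hypTerm A B C D E k =
      (E - A) * (E - B) / ((C - D + 1) * E) * ∑' k, hypTerm A B (C + 1) D (E + 1) k -
        Gamma D * Gamma E / ((C - D + 1) * Gamma A * Gamma B * Gamma (C + 1)) := by
  have hC1 := add_one_ne_neg hC
  have hE1 := add_one_ne_neg hEn
  have hC0 := ne_zero_of_ne_neg hC
  have hE0 := ne_zero_of_ne_neg hEn
  have s1 : Summable fun k => hypTerm A B C D E k :=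
    (summable_norm_hypTerm hA hB hC hD hEn (by simp [hE]; linarith)).of_norm
  have s2 : Summable fun k => hypTerm A B (C + 1) D (E + 1) k :=
    (summable_norm_hypTerm hA hB hC1 hD hE1 (by simp [hE]; linarith)).of_norm
  have key : ∑' k, ((C - D + 1) * hypTerm A B C D E k -
      (E - A) * (E - B) / E * hypTerm A B (C + 1) D (E + 1) k) =
      -(1 * 1 * (Gamma D * Gamma E / (Gamma A * Gamma B * Gamma C)) / C) := by
    refine tsum_eq_of_telescoping
      (g := fun k => -(k * (D + k - 1) * hypTerm A B C D E k / C))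
      ((s1.mul_left _).sub (s2.mul_left _)) (fun k => ?_) (by simp) ?_
    · have hk : hypTerm A B (C + 1) D (E + 1) k =
          hypTerm A B C D E k * ((C + k) * E / (C * (E + k))) := by
        have h1 := poch_succ_left C k
        have h2 := poch_succ_left E k
        rw [poch_succ] at h1 h2
        have := poch_ne_zero hEn k
        have := poch_ne_zero hD k
        have := poch_ne_zero hE1 k
        have := add_natCast_ne_zero hEn k
        have hfac : (k.factorial : ℂ) ≠ 0 := by exact_mod_cast k.factorial_ne_zero
        have e1 : poch (C + 1) k = poch C k * (C + k) / C := by field_simp; linear_combination -h1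
        have e2 : poch (E + 1) k = poch E k * (E + k) / E := by field_simp; linear_combination -h2
        rw [hypTerm, hypTerm, e1, e2]
        field_simp
      have := add_natCast_ne_zero hEn k
      have := add_natCast_ne_zero hD k
      have hn1 : (k : ℂ) + 1 ≠ 0 := by exact_mod_cast k.succ_ne_zero
      have e3 : ((k + 1 : ℕ) : ℂ) * (D + (k + 1 : ℕ) - 1) * hypTerm A B C D E (k + 1) / C =
          hypTerm A B C D E k * ((A + k) * (B + k) * (C + k) / ((E + k) * C)) := by
        rw [hypTerm_succ]
        push_cast
        rw [show D + ((k : ℂ) + 1) - 1 = D + k by ring]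
        field_simp
      rw [hk, e3]
      generalize hypTerm A B C D E k = t
      field_simp
      rw [hE]
      ring
    · obtain ⟨r, hr, h⟩ := exists_hypTerm_eq hA hB hC hD hEn
      have hl := (((tendsto_natCast_div_add_atTop (1 : ℂ)).mul
        (tendsto_add_natCast_div_add_natCast (D - 1) 1)).mul hr).div_const C
      refine hl.neg.congr fun n => ?_
      have hn1 : (n : ℂ) + 1 ≠ 0 := by exact_mod_cast n.succ_ne_zero
      rw [h, show A + B + C - D - E - 1 = ((-2 : ℤ) : ℂ) by rw [hE]; push_cast; ring, cpow_intCast,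
        add_comm 1 (n : ℂ)]
      rw [zpow_neg]
      norm_cast
      push_cast
      field_simp
      ring
  rw [(s1.mul_left _).tsum_sub (s2.mul_left _), tsum_mul_left, tsum_mul_left] at key
  have := Gamma_ne_zero hA
  have := Gamma_ne_zero hB
  have := Gamma_ne_zero hC
  rw [Gamma_add_one _ hC0]
  field_simp at key ⊢
  linear_combination key

theorem tsum_saalschutzian_eq_shift {A B C D E : ℂ} (hE : E = A + B + C + 1 - D)
    (hA : ∀ m : ℕ, A ≠ -(m : ℂ)) (hB : ∀ m : ℕ, B ≠ -(m : ℂ)) (hC : ∀ m : ℕ, C ≠ -(m : ℂ))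
    (hD : ∀ m : ℕ, D ≠ -(m : ℂ)) (hEn : ∀ m : ℕ, E ≠ -(m : ℂ))
    (hCD : ∀ m : ℕ, C - D + 1 ≠ -(m : ℂ)) (n : ℕ) :
    ∑' k, hypTerm A B C D E k =
      hypTerm (E - A) (E - B) 1 (C - D + 1) E n * ∑' k, hypTerm A B (C + n) D (E + n) k -
        Gamma D * Gamma E / ((C - D + 1) * Gamma A * Gamma B * Gamma (C + 1)) *
          ∑ j ∈ Finset.range n, hypTerm (E - A) (E - B) 1 (C + 1) (C - D + 1 + 1) j := by
  induction n with
  | zero => simp [hypTerm_zero]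
  | succ n ih =>
    have hn1 : (n : ℂ) + 1 ≠ 0 := by exact_mod_cast n.succ_ne_zero
    have hcn := add_natCast_ne_zero hCD n
    have hc0 := ne_zero_of_ne_neg hCD
    have hq : hypTerm (E - A) (E - B) 1 (C - D + 1) E n *
        (Gamma D * Gamma (E + n) /
          ((C + n - D + 1) * Gamma A * Gamma B * Gamma (C + n + 1))) =
        Gamma D * Gamma E / ((C - D + 1) * Gamma A * Gamma B * Gamma (C + 1)) *
          hypTerm (E - A) (E - B) 1 (C + 1) (C - D + 1 + 1) n := by
      have h1 := poch_succ_left (C - D + 1) n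
      rw [poch_succ] at h1
      have e1 : poch (C - D + 1 + 1) n = poch (C - D + 1) n * (C - D + 1 + n) / (C - D + 1) := by
        field_simp
        linear_combination -h1
      have := Gamma_ne_zero hA
      have := Gamma_ne_zero hB
      have := Gamma_ne_zero (add_one_ne_neg hC)
      have := poch_ne_zero (add_one_ne_neg hC) n
      have := poch_ne_zero hCD n
      have := poch_ne_zero hEn n
      have hfac : (n.factorial : ℂ) ≠ 0 := by exact_mod_cast n.factorial_ne_zero
      rw [Gamma_add_natCast hEn, show C + (n : ℂ) + 1 = C + 1 + n by ring,
        Gamma_add_natCast (add_one_ne_neg hC), hypTerm, hypTerm, e1,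
        show C + (n : ℂ) - D + 1 = C - D + 1 + n by ring]
      generalize C - D + 1 = c at *
      field_simp
    rw [ih, tsum_saalschutzian_succ (C := C + n) (E := E + n) (by rw [hE]; ring) hA hB
      (add_natCast_ne_neg hC n) hD (add_natCast_ne_neg hEn n)
      (by rwa [show C + (n : ℂ) - D + 1 = C - D + 1 + n by ring]), mul_sub, hq,
      Finset.sum_range_succ, hypTerm_succ, Nat.cast_succ, ← add_assoc, ← add_assoc, add_comm 1 (n : ℂ),
      mul_div_mul_right _ _ hn1, show C + (n : ℂ) - D + 1 = C - D + 1 + n by ring,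
      show E + (n : ℂ) - A = E - A + n by ring, show E + (n : ℂ) - B = E - B + n by ring]
    ring

/-- Uniform bound for the ratios `(c + n)_k / (e + n)_k`. -/
theorem exists_norm_poch_shift_div_le {c e : ℂ} (hc : ∀ m : ℕ, c ≠ -(m : ℂ))
    (he : ∀ m : ℕ, e ≠ -(m : ℂ)) :
    ∃ K : ℝ, 0 ≤ K ∧ ∀ n k : ℕ,
      ‖poch (c + n) k / poch (e + n) k‖ ≤ K * (1 + ((k : ℝ) + 1) ^ (c - e).re) := by
  obtain ⟨K₁, h₁, hK₁⟩ := exists_norm_hypTerm_le hc one_ne_neg one_ne_neg he one_ne_neg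
  obtain ⟨K₂, h₂, hK₂⟩ := exists_norm_hypTerm_le he one_ne_neg one_ne_neg hc one_ne_neg
  have hsimp : ∀ (x y : ℂ) (n : ℕ), hypTerm x 1 1 y 1 n = poch x n / poch y n := fun x y n => by
    have hfac : (n.factorial : ℂ) ≠ 0 := by exact_mod_cast n.factorial_ne_zero
    rw [hypTerm, poch_one_eq_factorial, mul_assoc, mul_assoc,
      mul_div_mul_right _ _ (mul_ne_zero hfac hfac)]
  have hexp : ∀ x y : ℂ, (x + 1 + 1 - y - 1 - 1).re = (x - y).re := fun x y => by simp; ring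
  simp only [hsimp, hexp] at hK₁ hK₂
  refine ⟨K₁ * K₂, by positivity, fun n k => ?_⟩
  have hcn := poch_ne_zero hc n
  have hen := poch_ne_zero he n
  have hfact : poch (c + n) k / poch (e + n) k =
      poch c (n + k) / poch e (n + k) * (poch e n / poch c n) := by
    rw [poch_add, poch_add]
    field_simp
  have hn : (0 : ℝ) < (n : ℝ) + 1 := by positivity
  have hk : (0 : ℝ) < (k : ℝ) + 1 := by positivity
  set s := (c - e).re with hs
  have hs' : (e - c).re = -s := by rw [hs]; simp
  set q : ℝ := (((n + k : ℕ) : ℝ) + 1) / ((n : ℝ) + 1) with hq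
  have hq1 : 1 ≤ q := by
    rw [hq, one_le_div hn]
    push_cast
    linarith [(Nat.cast_nonneg k : (0 : ℝ) ≤ k)]
  have hqk : q ≤ k + 1 := by
    rw [hq, div_le_iff₀ hn]
    push_cast
    nlinarith [(Nat.cast_nonneg k : (0 : ℝ) ≤ k), (Nat.cast_nonneg n : (0 : ℝ) ≤ n)]
  have hqs : q ^ s ≤ 1 + ((k : ℝ) + 1) ^ s := by
    rcases le_total 0 s with h | h
    · linarith [Real.rpow_le_rpow (by linarith) hqk h]
    · linarith [Real.rpow_le_one_of_one_le_of_nonpos hq1 h, Real.rpow_nonneg hk.le s]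
  rw [hfact, norm_mul]
  calc _ ≤ (K₁ * (((n + k : ℕ) : ℝ) + 1) ^ s) * (K₂ * ((n : ℝ) + 1) ^ (-s)) := by
        gcongr
        · exact hK₁ _
        · exact hs' ▸ hK₂ n
    _ = K₁ * K₂ * q ^ s := by
        rw [hq, Real.div_rpow (by positivity) hn.le, Real.rpow_neg hn.le]
        ring
    _ ≤ _ := by gcongr

theorem tendsto_tsum_saalschutzian_shift {A B C D E : ℂ} (hE : E = A + B + C + 1 - D)
    (hA : ∀ m : ℕ, A ≠ -(m : ℂ)) (hB : ∀ m : ℕ, B ≠ -(m : ℂ)) (hC : ∀ m : ℕ, C ≠ -(m : ℂ))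
    (hD : ∀ m : ℕ, D ≠ -(m : ℂ)) (hEn : ∀ m : ℕ, E ≠ -(m : ℂ)) (hs : 0 < (D - A - B).re) :
    Tendsto (fun n : ℕ => ∑' k, hypTerm A B (C + n) D (E + n) k) atTop
      (𝓝 (∑' k, hypTerm A B 1 D 1 k)) := by
  obtain ⟨K₁, h₁, hK₁⟩ := exists_norm_hypTerm_le hA hB one_ne_neg hD one_ne_neg
  obtain ⟨K₂, h₂, hK₂⟩ := exists_norm_poch_shift_div_le hC hEn
  have hfact : ∀ n k : ℕ, hypTerm A B (C + n) D (E + n) k =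
      hypTerm A B 1 D 1 k * (poch (C + n) k / poch (E + n) k) := fun n k => by
    have hfac : (k.factorial : ℂ) ≠ 0 := by exact_mod_cast k.factorial_ne_zero
    have := poch_ne_zero hD k
    have := poch_ne_zero (add_natCast_ne_neg hEn n) k
    rw [hypTerm, hypTerm, poch_one_eq_factorial]
    field_simp
  set δ := (D - A - B).re with hδ
  have e1 : (A + B + 1 - D - 1 - 1).re = -δ - 1 := by rw [hδ]; simp; ring
  have e2 : (C - E).re = δ - 1 := by rw [hδ, hE]; simp; ring
  rw [e1] at hK₁
  rw [e2] at hK₂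
  have hsum : Summable fun k : ℕ =>
      K₁ * K₂ * (((k : ℝ) + 1) ^ (-δ - 1) + ((k : ℝ) + 1) ^ (-2 : ℝ)) :=
    ((summable_add_one_rpow (by linarith)).add (summable_add_one_rpow (by norm_num))).mul_left _
  refine tendsto_tsum_of_dominated_convergence hsum (fun k => ?_) (.of_forall fun n k => ?_)
  · have h : Tendsto (fun n : ℕ => ∏ i ∈ Finset.range k, (C + i + n) / (E + i + n)) atTop
        (𝓝 (∏ i ∈ Finset.range k, 1)) :=
      tendsto_finsetProd _ fun i _ => tendsto_add_natCast_div_add_natCast _ _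
    rw [Finset.prod_const_one] at h
    have h' := h.const_mul (hypTerm A B 1 D 1 k)
    rw [mul_one] at h'
    refine h'.congr fun n => ?_
    rw [hfact, poch, poch, ← Finset.prod_div_distrib]
    congr 1
    exact Finset.prod_congr rfl fun i _ => by rw [add_right_comm C, add_right_comm E]
  · have hk : (0 : ℝ) < (k : ℝ) + 1 := by positivity
    rw [hfact, norm_mul]
    calc _ ≤ (K₁ * ((k : ℝ) + 1) ^ (-δ - 1)) * (K₂ * (1 + ((k : ℝ) + 1) ^ (δ - 1))) := by
          gcongr
          · exact hK₁ k
          · exact hK₂ n k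
      _ = _ := by
          rw [show (-2 : ℝ) = (-δ - 1) + (δ - 1) by ring, Real.rpow_add hk]
          ring

/-- Nonterminating Saalschützian `₃F₂(1)` series as a combination of a Gamma quotient and
another `₃F₂(1)` series. -/
theorem tsum_saalschutzian {A B C D E : ℂ} (hE : E = A + B + C + 1 - D)
    (hA : ∀ m : ℕ, A ≠ -(m : ℂ)) (hB : ∀ m : ℕ, B ≠ -(m : ℂ)) (hC : ∀ m : ℕ, C ≠ -(m : ℂ))
    (hD : ∀ m : ℕ, D ≠ -(m : ℂ)) (hEn : ∀ m : ℕ, E ≠ -(m : ℂ))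
    (hCD : ∀ m : ℕ, C - D + 1 ≠ -(m : ℂ)) (hDA : ∀ m : ℕ, D - A ≠ -(m : ℂ))
    (hDB : ∀ m : ℕ, D - B ≠ -(m : ℂ)) (hEA : ∀ m : ℕ, E - A ≠ -(m : ℂ))
    (hEB : ∀ m : ℕ, E - B ≠ -(m : ℂ)) (hs : 0 < (D - A - B).re) :
    ∑' k, hypTerm A B C D E k =
      Gamma (C - D + 1) * Gamma E / (Gamma (E - A) * Gamma (E - B)) *
          (Gamma D * Gamma (D - A - B) / (Gamma (D - A) * Gamma (D - B))) -
        Gamma D * Gamma E / ((C - D + 1) * Gamma A * Gamma B * Gamma (C + 1)) *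
          ∑' k, hypTerm (E - A) (E - B) 1 (C + 1) (C - D + 1 + 1) k := by
  have hsum : Summable fun k => hypTerm (E - A) (E - B) 1 (C + 1) (C - D + 1 + 1) k :=
    (summable_norm_hypTerm hEA hEB one_ne_neg (add_one_ne_neg hC) (add_one_ne_neg hCD)
      (by simp [hE] at hs ⊢; linarith)).of_norm
  obtain ⟨r, hr, h⟩ := exists_hypTerm_eq hEA hEB one_ne_neg hCD hEn
  have hlim := (hr.mul (tendsto_tsum_saalschutzian_shift hE hA hB hC hD hEn hs)).sub
    (hsum.hasSum.tendsto_sum_nat.const_mul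
      (Gamma D * Gamma E / ((C - D + 1) * Gamma A * Gamma B * Gamma (C + 1))))
  rw [Gamma_one, mul_one, tsum_gauss hA hB hD hDA hDB hs] at hlim
  refine tendsto_nhds_unique (tendsto_const_nhds.congr fun n => ?_) hlim
  rw [tsum_saalschutzian_eq_shift hE hA hB hC hD hEn hCD n, h,
    show E - A + (E - B) + 1 - (C - D + 1) - E - 1 = 0 by rw [hE]; ring, cpow_zero, mul_one]

theorem transformed_saalschutzian (a b c e : ℂ)
    (hre1 : 0 < (1 + b - e).re) (hre2 : 0 < (e - a - b).re)
    (hc : c ≠ 0)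
    (h : ∀ z ∈ [c, 2 - e, c - e + 2, c + 1, a + b + c - 2 * e + 2, e - a - b,
        a - e + 1, b - e + 1, c - e + 1, 1 - a, 1 - b, 1 + a + c - e, 1 + b + c - e],
      ∀ m : ℕ, z ≠ -(m : ℂ)) :
    (Summable fun k : ℕ =>
      ‖poch (b - e + 1) k * poch (a - e + 1) k * poch (c - e + 1) k /
        (poch (2 - e) k * poch (a + b + c - 2 * e + 2) k * (Nat.factorial k : ℂ))‖) ∧
    (Summable fun k : ℕ =>
      ‖poch (1 + b + c - e) k * poch (1 + a + c - e) k * poch 1 k /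
        (poch (2 + c - e) k * poch (c + 1) k * (Nat.factorial k : ℂ))‖) ∧
    ∑' k : ℕ, poch (b - e + 1) k * poch (a - e + 1) k * poch (c - e + 1) k /
        (poch (2 - e) k * poch (a + b + c - 2 * e + 2) k * (Nat.factorial k : ℂ)) =
      -(Complex.Gamma (2 - e) * Complex.Gamma (a + b + c - 2 * e + 2) /
          (c * Complex.Gamma (b - e + 1) * Complex.Gamma (a - e + 1) *
            Complex.Gamma (c - e + 2))) *
        (∑' k : ℕ, poch (1 + b + c - e) k * poch (1 + a + c - e) k * poch 1 k /
          (poch (2 + c - e) k * poch (c + 1) k * (Nat.factorial k : ℂ))) +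
      Complex.Gamma (e - a - b) * Complex.Gamma c * Complex.Gamma (2 - e) *
          Complex.Gamma (a + b + c - 2 * e + 2) /
        (Complex.Gamma (1 - b) * Complex.Gamma (1 + b + c - e) * Complex.Gamma (1 - a) *
          Complex.Gamma (a + c - e + 1)) := by
  simp only [List.forall_mem_cons] at h
  obtain ⟨h1, h2, h3, h4, h5, -, h7, h8, h9, h10, h11, h12, h13, -⟩ := h
  have e1 : a + b + c - 2 * e + 2 - (b - e + 1) = 1 + a + c - e := by ring
  have e2 : a + b + c - 2 * e + 2 - (a - e + 1) = 1 + b + c - e := by ring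
  have e3 : c - e + 1 - (2 - e) + 1 = c := by ring
  have e4 : 2 - e - (b - e + 1) = 1 - b := by ring
  have e5 : 2 - e - (a - e + 1) = 1 - a := by ring
  have e6 : 1 - a - (b - e + 1) = e - a - b := by ring
  have e7 : c - e + 1 + 1 = 2 + c - e := by ring
  have e8 : c - e + 2 = 2 + c - e := by ring
  have e9 : a + c - e + 1 = 1 + a + c - e := by ring
  have hcomm : ∀ k, hypTerm (a - e + 1) (b - e + 1) (c - e + 1) (2 - e)
      (a + b + c - 2 * e + 2) k = hypTerm (b - e + 1) (a - e + 1) (c - e + 1) (2 - e)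
      (a + b + c - 2 * e + 2) k := fun k => by
    rw [hypTerm, hypTerm, mul_comm (poch (a - e + 1) k)]
  have key := tsum_saalschutzian (A := a - e + 1) (B := b - e + 1) (C := c - e + 1)
    (D := 2 - e) (E := a + b + c - 2 * e + 2) (by ring) h7 h8 h9 h2 h5
    (by rwa [e3]) (by rwa [e5]) (by rwa [e4]) (by rwa [e2]) (by rwa [e1]) (by rwa [e5, e6])
  simp only [e1, e2, e3, e4, e5, e6, e7, hcomm] at key
  refine ⟨summable_norm_hypTerm h8 h7 h9 h2 h5 (by simp; linarith),
    summable_norm_hypTerm h13 h12 one_ne_neg (e8 ▸ h3) h4 (by simp at hre2 ⊢; linarith),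
    key.trans ?_⟩
  simp only [hypTerm, e8, e9]
  ring
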